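/- Let n ≥ 3 and 0 ≤ α < 1/2. Then there exists a constant C = C(n, α) such that for every Schwartz function φ₀ on ℝⁿ, the solution φ of the free Schrödinger equation i φ_t = −Δφ with φ(·,0) = φ₀ satisfies ∫_{−∞}^{∞} ∫_{ℝⁿ} | |∇|^α φ(x,t) |² / |x|^{2−2α} dx dt ≤ C ‖φ₀‖_{L²(ℝⁿ)}². -/

import Mathlib

open MeasureTheory Real SchwartzMap

noncomputable section

/-- The Fourier transform `φ̂₀(ξ) = ∫ e^{-i x·ξ} φ₀(x) dx` on `ℝⁿ`. -/
def fourierInt {n : ℕ} (f : EuclideanSpace ℝ (Fin n) → ℂ) (ξ : EuclideanSpace ℝ (Fin n)) : ℂ :=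
  ∫ x : EuclideanSpace ℝ (Fin n), Complex.exp (-(Complex.I * ((inner ℝ x ξ : ℝ) : ℂ))) * f x

/-- `|∇|^α φ(x,t) = (2π)^{-n} ∫ |ξ|^α e^{i x·ξ} e^{-i t |ξ|^β} φ̂₀(ξ) dξ`, where `φ` is the
solution of `i φ_t = (-Δ)^{β/2} φ` with initial data `φ₀`. -/
def gradProp {n : ℕ} (α β : ℝ) (φ₀ : 𝓢(EuclideanSpace ℝ (Fin n), ℂ))
    (x : EuclideanSpace ℝ (Fin n)) (t : ℝ) : ℂ :=
  ((2 * π) ^ n : ℝ)⁻¹ *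
    ∫ ξ : EuclideanSpace ℝ (Fin n),
      ((‖ξ‖ ^ α : ℝ) : ℂ) * Complex.exp (Complex.I * ((inner ℝ x ξ : ℝ) : ℂ)) *
        Complex.exp (-(Complex.I * (t : ℂ) * ((‖ξ‖ ^ β : ℝ) : ℂ))) *
          fourierInt (fun y => φ₀ y) ξ

end

open scoped ENNReal

theorem lintegral_polar {E : Type*} [NormedAddCommGroup E] [NormedSpace ℝ E]
    [MeasurableSpace E] [BorelSpace E] [FiniteDimensional ℝ E] [Nontrivial E]
    (μ : Measure E) [μ.IsAddHaarMeasure] {h : E → ℝ≥0∞} {k : ℝ → ℝ≥0∞}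
    (hh : Measurable h) (hk : Measurable k) :
    ∫⁻ x, h (‖x‖⁻¹ • x) * k ‖x‖ ∂μ =
      (∫⁻ ω, h ω.1 ∂μ.toSphere) *
        ∫⁻ r in Set.Ioi (0 : ℝ), ENNReal.ofReal (r ^ (Module.finrank ℝ E - 1)) * k r := by
  have key := μ.measurePreserving_homeomorphUnitSphereProd.lintegral_comp_emb
    (Homeomorph.measurableEmbedding _) (fun p => h p.1.1 * k p.2.1)
  have hk' : Measurable fun r : Set.Ioi (0 : ℝ) => k r.1 := hk.comp measurable_subtype_coe
  have hh' : Measurable fun ω : Metric.sphere (0 : E) 1 => h ω.1 :=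
    hh.comp measurable_subtype_coe
  rw [lintegral_prod_mul (f := fun ω : Metric.sphere (0 : E) 1 => h ω.1)
    (g := fun r : Set.Ioi (0 : ℝ) => k r.1) hh'.aemeasurable hk'.aemeasurable,
    Measure.volumeIoiPow, lintegral_withDensity_eq_lintegral_mul _ (by fun_prop) hk'] at key
  have e2 := lintegral_subtype_comap (μ := (volume : Measure ℝ)) (s := Set.Ioi (0 : ℝ))
    measurableSet_Ioi (fun r => ENNReal.ofReal (r ^ (Module.finrank ℝ E - 1)) * k r)
  have e1 := lintegral_subtype_comap (μ := μ) (s := ({0}ᶜ : Set E))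
    (measurableSet_singleton _).compl (fun x => h (‖x‖⁻¹ • x) * k ‖x‖)
  rw [restrict_compl_singleton] at e1
  rw [← e1, ← e2]
  simpa using key

theorem lintegral_ofReal_mul_comp_sub_sq_le (g : ℝ → ℝ≥0∞) (R : ℝ) :
    ∫⁻ r in Set.Ioi (0 : ℝ), ENNReal.ofReal r * g (R ^ 2 - r ^ 2) ≤ ∫⁻ s, g s := by
  have h1 := lintegral_image_eq_lintegral_abs_deriv_mul (s := Set.Ioi (0 : ℝ)) measurableSet_Ioi
    (f := fun r => R ^ 2 - r ^ 2) (f' := fun r => - (2 * r))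
    (fun r _ => by
      have := ((hasDerivAt_pow 2 r).const_sub (R ^ 2)).hasDerivWithinAt (s := Set.Ioi 0)
      simpa using this)
    (fun x hx y hy hxy => by
      have : x ^ 2 = y ^ 2 := by simpa using hxy
      exact (pow_left_inj₀ (le_of_lt hx) (le_of_lt hy) two_ne_zero).1 this) g
  calc _ ≤ ∫⁻ r in Set.Ioi (0 : ℝ), ENNReal.ofReal |-(2 * r)| * g (R ^ 2 - r ^ 2) := by
        refine setLIntegral_mono' measurableSet_Ioi fun r hr => ?_
        have : r ≤ |-(2 * r)| := by
          rw [abs_neg, abs_of_nonneg (by linarith [hr.out])]; linarith [hr.out]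
        gcongr
    _ = _ := h1.symm
    _ ≤ _ := setLIntegral_le_lintegral _ _

theorem max_mul_sqrt_le_norm_sub {E : Type*} [NormedAddCommGroup E] [InnerProductSpace ℝ E]
    {e ω : E} (he : ‖e‖ = 1) (hω : ‖ω‖ = 1) (R r : ℝ) :
    max R r * √(1 - (inner ℝ e ω) ^ 2) ≤ ‖R • e - r • ω‖ := by
  have hsq : ‖R • e - r • ω‖ ^ 2 = R ^ 2 - 2 * R * r * inner ℝ e ω + r ^ 2 := by
    rw [norm_sub_sq_real, inner_smul_left, inner_smul_right, norm_smul, norm_smul, he, hω]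
    simp; ring
  have hc : (0 : ℝ) ≤ 1 - (inner ℝ e ω) ^ 2 := by
    have := abs_real_inner_le_norm e ω
    rw [he, hω, mul_one, ← sq_le_one_iff_abs_le_one] at this
    linarith
  refine le_of_sq_le_sq ?_ (norm_nonneg _)
  rw [mul_pow, sq_sqrt hc, hsq]
  rcases max_cases R r with ⟨h, _⟩ | ⟨h, _⟩ <;> rw [h]
  · nlinarith [sq_nonneg (r - R * inner ℝ e ω)]
  · nlinarith [sq_nonneg (R - r * inner ℝ e ω)]

theorem lintegral_ball_norm_rpow_neg_lt_top {E : Type*} [NormedAddCommGroup E] [NormedSpace ℝ E]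
    [MeasurableSpace E] [BorelSpace E] [FiniteDimensional ℝ E] [Nontrivial E]
    (μ : Measure E) [μ.IsAddHaarMeasure] {b : ℝ} (hb : b < Module.finrank ℝ E) :
    ∫⁻ x in Metric.ball (0 : E) 1, ‖x‖ₑ ^ (-b) ∂μ < ∞ := by
  have hint : IntegrableOn (fun x : E => ‖x‖ ^ (-b)) (Metric.ball (0 : E) 1) μ := by
    rw [integrableOn_fun_norm_addHaar μ (f := fun r => r ^ (-b))]
    have : IntegrableOn (fun y : ℝ => y ^ ((Module.finrank ℝ E : ℝ) - 1 - b)) (Set.Ioo 0 1) := by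
      rw [intervalIntegral.integrableOn_Ioo_rpow_iff one_pos]
      linarith
    refine this.congr_fun (fun y hy => ?_) measurableSet_Ioo
    have hpos : 1 ≤ Module.finrank ℝ E := Module.finrank_pos
    simp only [smul_eq_mul]
    rw [← rpow_natCast, ← rpow_add hy.1]
    push_cast [hpos]
    ring_nf
  refine lt_of_eq_of_lt (lintegral_congr_ae ?_) hint.2
  filter_upwards [ae_restrict_of_ae (Measure.ae_ne μ (0 : E))] with x hx
  rw [← ofReal_norm, ← ofReal_norm, Real.norm_of_nonneg (by positivity),
    ENNReal.ofReal_rpow_of_pos (by positivity)]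

theorem lintegral_ball_sqrt_rpow_neg_le (m : ℕ) {b : ℝ} (hb : 0 ≤ b)
    {e : EuclideanSpace ℝ (Fin (m + 1))} (he : ‖e‖ = 1) :
    ∫⁻ y in Metric.ball (0 : EuclideanSpace ℝ (Fin (m + 1))) 1,
        ENNReal.ofReal (√(‖y‖ ^ 2 - (inner ℝ e y) ^ 2)) ^ (-b) ≤
      2 * ∫⁻ z in Metric.ball (0 : Fin m → ℝ) 1, ‖z‖ₑ ^ (-b) := by
  obtain ⟨B, hB⟩ := Orthonormal.exists_orthonormalBasis_extension_of_card_eq (𝕜 := ℝ)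
    (E := EuclideanSpace ℝ (Fin (m + 1))) (ι := Fin (m + 1)) (by simp) (v := fun _ => e)
    (s := {0}) (by
      constructor
      · intro i; simpa using he
      · intro i j hij; exact absurd (Subsingleton.elim i j) hij)
  have hB0 : B 0 = e := hB 0 rfl
  let G : ℝ × (Fin m → ℝ) → ℝ≥0∞ := fun p =>
    (Metric.ball (0 : ℝ) 1).indicator 1 p.1 *
      (Metric.ball (0 : Fin m → ℝ) 1).indicator (fun z => ‖z‖ₑ ^ (-b)) p.2
  have hmp : MeasurePreserving (fun y : EuclideanSpace ℝ (Fin (m + 1)) =>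
      (MeasurableEquiv.piFinSuccAbove (fun _ => ℝ) 0) (WithLp.ofLp (B.repr y))) :=
    (volume_preserving_piFinSuccAbove (fun _ : Fin (m + 1) => ℝ) 0).comp
      ((PiLp.volume_preserving_ofLp (Fin (m + 1))).comp B.measurePreserving_repr)
  have h1 : Measurable ((Metric.ball (0 : ℝ) 1).indicator (1 : ℝ → ℝ≥0∞)) :=
    measurable_one.indicator Metric.isOpen_ball.measurableSet
  have h2 : Measurable ((Metric.ball (0 : Fin m → ℝ) 1).indicator
      (fun z => ‖z‖ₑ ^ (-b))) :=
    (Measurable.pow_const (by fun_prop) _).indicator Metric.isOpen_ball.measurableSet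
  have hG : Measurable G := (h1.comp measurable_fst).mul (h2.comp measurable_snd)
  have hGint : ∫⁻ p, G p = 2 * ∫⁻ z in Metric.ball (0 : Fin m → ℝ) 1, ‖z‖ₑ ^ (-b) := by
    rw [Measure.volume_eq_prod, lintegral_prod_mul h1.aemeasurable h2.aemeasurable,
      lintegral_indicator_one Metric.isOpen_ball.measurableSet,
      lintegral_indicator Metric.isOpen_ball.measurableSet, Real.volume_ball]
    norm_num
  rw [← hGint, ← hmp.lintegral_comp hG, ← lintegral_indicator Metric.isOpen_ball.measurableSet]
  refine lintegral_mono fun y => ?_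
  by_cases hy : y ∈ Metric.ball (0 : EuclideanSpace ℝ (Fin (m + 1))) 1
  swap
  · simp [hy]
  rw [Set.indicator_of_mem hy]
  have hy' : ‖y‖ < 1 := by simpa using hy
  set c := B.repr y with hc
  have hnorm : ‖c‖ = ‖y‖ := B.repr.norm_map y
  have hci : ∀ i, |c i| ≤ ‖y‖ := fun i => by
    rw [← hnorm]; exact PiLp.norm_apply_le c i
  have hc0 : inner ℝ e y = c 0 := by rw [← hB0, hc, B.repr_apply_apply]
  have hsum : ‖y‖ ^ 2 = c 0 ^ 2 + ∑ i : Fin m, c i.succ ^ 2 := by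
    rw [← hnorm, EuclideanSpace.real_norm_sq_eq, Fin.sum_univ_succ]
  let z : Fin m → ℝ := fun i => c i.succ
  have hz1 : ‖z‖ < 1 := lt_of_le_of_lt
    ((pi_norm_le_iff_of_nonneg (norm_nonneg _)).2 fun i => hci i.succ) hy'
  have hzs : ‖z‖ ≤ √(‖y‖ ^ 2 - (inner ℝ e y) ^ 2) := by
    refine (pi_norm_le_iff_of_nonneg (sqrt_nonneg _)).2 fun i => abs_le_sqrt ?_
    rw [hc0, hsum, add_sub_cancel_left]
    exact Finset.single_le_sum (f := fun i : Fin m => c i.succ ^ 2)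
      (fun i _ => sq_nonneg _) (Finset.mem_univ i)
  have hval : G ((MeasurableEquiv.piFinSuccAbove (fun _ => ℝ) 0) (WithLp.ofLp c)) =
      ‖z‖ₑ ^ (-b) := by
    have e1 : ((MeasurableEquiv.piFinSuccAbove (fun _ => ℝ) 0) (WithLp.ofLp c)) = (c 0, z) := rfl
    have hc1 : c 0 ∈ Metric.ball (0 : ℝ) 1 := by
      simpa using (hci 0).trans_lt hy'
    have hz2 : z ∈ Metric.ball (0 : Fin m → ℝ) 1 := by simpa using hz1
    simp only [G, e1, Set.indicator_of_mem hc1, Set.indicator_of_mem hz2, Pi.one_apply, one_mul]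
  rw [hval, ENNReal.rpow_neg, ENNReal.rpow_neg, ← ofReal_norm]
  gcongr

theorem exists_lintegral_sphere_sqrt_rpow_neg_le (m : ℕ) {b : ℝ} (hb : 0 ≤ b) (hbm : b < m) :
    ∃ Q : ℝ≥0∞, Q < ∞ ∧ ∀ e : EuclideanSpace ℝ (Fin (m + 1)), ‖e‖ = 1 →
      ∫⁻ ω, ENNReal.ofReal (√(1 - (inner ℝ e ω.1) ^ 2)) ^ (-b)
        ∂(volume : Measure (EuclideanSpace ℝ (Fin (m + 1)))).toSphere ≤ Q := by
  have : Nonempty (Fin m) := by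
    refine ⟨⟨0, ?_⟩⟩
    have := hb.trans_lt hbm
    exact_mod_cast this
  set R : ℝ≥0∞ := ∫⁻ r in Set.Ioi (0 : ℝ), ENNReal.ofReal
    (r ^ (Module.finrank ℝ (EuclideanSpace ℝ (Fin (m + 1))) - 1)) *
      (Set.Iio (1 : ℝ)).indicator 1 r with hR
  have hkm : Measurable ((Set.Iio (1 : ℝ)).indicator (1 : ℝ → ℝ≥0∞)) :=
    measurable_one.indicator measurableSet_Iio
  have hR0 : R ≠ 0 := by
    rw [hR, Ne, lintegral_eq_zero_iff (by fun_prop), Filter.EventuallyEq, ae_restrict_iff'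
      measurableSet_Ioi]
    intro h0
    have h3 : volume (Set.Ioo (0 : ℝ) 1) = 0 := by
      refine measure_mono_null ?_ h0
      intro r hr
      have h4 : 0 < r ^ m := pow_pos hr.1 _
      simp [hr.1, hr.2, h4]
    simp at h3
  have hfin : ∫⁻ z in Metric.ball (0 : Fin m → ℝ) 1, ‖z‖ₑ ^ (-b) < ∞ :=
    lintegral_ball_norm_rpow_neg_lt_top _ (by simpa using hbm)
  refine ⟨(2 * ∫⁻ z in Metric.ball (0 : Fin m → ℝ) 1, ‖z‖ₑ ^ (-b)) / R,
    ENNReal.div_lt_top (ENNReal.mul_lt_top (by simp) hfin).ne hR0, fun e he => ?_⟩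
  have hhm : Measurable fun ω : EuclideanSpace ℝ (Fin (m + 1)) =>
      ENNReal.ofReal (√(1 - (inner ℝ e ω) ^ 2)) ^ (-b) :=
    (Continuous.measurable (by fun_prop)).ennreal_ofReal.pow_const _
  have key := lintegral_polar (volume : Measure (EuclideanSpace ℝ (Fin (m + 1)))) hhm hkm
  have hle := lintegral_ball_sqrt_rpow_neg_le m hb he
  refine ENNReal.le_div_iff_mul_le (Or.inl hR0) (Or.inr ?_) |>.2 ?_
  · exact (ENNReal.mul_lt_top (by simp) hfin).ne
  rw [hR, ← key]
  refine le_trans ?_ hle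
  rw [← lintegral_indicator Metric.isOpen_ball.measurableSet]
  refine lintegral_mono fun y => ?_
  by_cases hy : ‖y‖ < 1
  · have hy1 : y ∈ Metric.ball (0 : EuclideanSpace ℝ (Fin (m + 1))) 1 := by simpa using hy
    have hy2 : ‖y‖ ∈ Set.Iio (1 : ℝ) := hy
    rw [Set.indicator_of_mem hy1, Set.indicator_of_mem hy2, Pi.one_apply, mul_one,
      ENNReal.rpow_neg, ENNReal.rpow_neg]
    refine ENNReal.inv_le_inv.2
      (ENNReal.rpow_le_rpow (ENNReal.ofReal_le_ofReal (sqrt_le_sqrt ?_)) hb)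
    rcases eq_or_ne y 0 with rfl | h0
    · simp
    have hpos : 0 < ‖y‖ := norm_pos_iff.2 h0
    rw [inner_smul_right]
    have hcs : inner ℝ e y ^ 2 ≤ ‖y‖ ^ 2 := by
      have := abs_real_inner_le_norm e y
      rw [he, one_mul] at this
      exact sq_le_sq' (abs_le.1 this).1 (abs_le.1 this).2
    have h5 : 1 - (‖y‖⁻¹ * inner ℝ e y) ^ 2 = (‖y‖ ^ 2 - inner ℝ e y ^ 2) / ‖y‖ ^ 2 := by
      field_simp
    rw [h5, le_div_iff₀ (by positivity)]
    exact mul_le_of_le_one_right (by linarith) (pow_le_one₀ hpos.le hy.le)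
  · simp [hy]

theorem exists_lintegral_kernel_le (n : ℕ) (hn : 3 ≤ n) {α : ℝ} (hα : 0 ≤ α) (hα' : α < 1 / 2) :
    ∃ Q : ℝ≥0∞, Q < ∞ ∧ ∀ (g : ℝ → ℝ≥0∞), Measurable g → ∀ ξ : EuclideanSpace ℝ (Fin n),
      ∫⁻ η, ENNReal.ofReal (‖ξ‖ ^ α * ‖η‖ ^ α) *
        (‖ξ - η‖ₑ ^ (-((n : ℝ) - 2 + 2 * α)) * g (‖ξ‖ ^ 2 - ‖η‖ ^ 2)) ≤ Q * ∫⁻ s, g s := by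
  obtain ⟨m, rfl⟩ : ∃ m, n = m + 1 := ⟨n - 1, by omega⟩
  have hm : (2 : ℝ) ≤ m := by
    have : 2 ≤ m := by omega
    exact_mod_cast this
  set b : ℝ := ((m + 1 : ℕ) : ℝ) - 2 + 2 * α with hb
  have hb1 : b = m - 1 + 2 * α := by rw [hb]; push_cast; ring
  have hb0 : 0 ≤ b := by linarith
  obtain ⟨Q, hQ, hQle⟩ := exists_lintegral_sphere_sqrt_rpow_neg_le m hb0 (by linarith)
  refine ⟨Q, hQ, fun g hg ξ => ?_⟩
  obtain ⟨e, he, hξ⟩ : ∃ e : EuclideanSpace ℝ (Fin (m + 1)), ‖e‖ = 1 ∧ ξ = ‖ξ‖ • e := by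
    rcases eq_or_ne ξ 0 with rfl | h0
    · obtain ⟨e, he⟩ := exists_norm_eq (EuclideanSpace ℝ (Fin (m + 1))) zero_le_one
      exact ⟨e, he, by simp⟩
    · exact ⟨‖ξ‖⁻¹ • ξ, by simp [norm_smul, h0], by simp [h0]⟩
  set R := ‖ξ‖ with hRdef
  have hR0 : 0 ≤ R := norm_nonneg _
  let k : ℝ → ℝ≥0∞ := fun r =>
    ENNReal.ofReal (R ^ α * r ^ α * max R r ^ (-b)) * g (R ^ 2 - r ^ 2)
  have hk : Measurable k := by fun_prop
  have hhm : Measurable fun ω : EuclideanSpace ℝ (Fin (m + 1)) =>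
      ENNReal.ofReal (√(1 - (inner ℝ e ω) ^ 2)) ^ (-b) :=
    (Continuous.measurable (by fun_prop)).ennreal_ofReal.pow_const _
  have key := lintegral_polar (volume : Measure (EuclideanSpace ℝ (Fin (m + 1)))) hhm hk
  calc _ ≤ ∫⁻ η, ENNReal.ofReal (√(1 - (inner ℝ e (‖η‖⁻¹ • η)) ^ 2)) ^ (-b) * k ‖η‖ := by
        refine lintegral_mono_ae ?_
        filter_upwards [Measure.ae_ne volume (0 : EuclideanSpace ℝ (Fin (m + 1)))] with η hη
        have hpos : 0 < ‖η‖ := norm_pos_iff.2 hη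
        have hM : 0 < max R ‖η‖ := lt_max_of_lt_right hpos
        have h1 := max_mul_sqrt_le_norm_sub he (ω := ‖η‖⁻¹ • η) (by simp [norm_smul, hη]) R ‖η‖
        rw [← hξ, smul_inv_smul₀ hpos.ne'] at h1
        have h2 : ‖ξ - η‖ₑ ^ (-b) ≤ ENNReal.ofReal (max R ‖η‖ ^ (-b)) *
            ENNReal.ofReal (√(1 - (inner ℝ e (‖η‖⁻¹ • η)) ^ 2)) ^ (-b) := by
          rw [← ENNReal.ofReal_rpow_of_pos hM, ← ENNReal.mul_rpow_of_ne_top (by simp) (by simp),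
            ← ENNReal.ofReal_mul hM.le, ENNReal.rpow_neg, ENNReal.rpow_neg, ← ofReal_norm]
          gcongr
        simp only [k]
        rw [ENNReal.ofReal_mul (by positivity) (q := max R ‖η‖ ^ (-b))]
        calc _ ≤ _ := mul_le_mul_right (mul_le_mul_left h2 _) _
          _ = _ := by ring
    _ = _ := key
    _ ≤ Q * ∫⁻ s, g s := by
        refine mul_le_mul' (hQle e he) ?_
        refine le_trans (setLIntegral_mono' measurableSet_Ioi fun r hr => ?_)
          (lintegral_ofReal_mul_comp_sub_sq_le g R)
        have hr : 0 < r := hr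
        simp only [k]
        rw [← mul_assoc, ← ENNReal.ofReal_mul (by positivity)]
        gcongr
        have hM : 0 < max R r := lt_max_of_lt_right hr
        have hfr : Module.finrank ℝ (EuclideanSpace ℝ (Fin (m + 1))) - 1 = m := by simp
        rw [hfr, rpow_neg hM.le, ← div_eq_mul_inv, ← mul_div_assoc, div_le_iff₀ (by positivity)]
        have h6 : r ^ m = r * r ^ ((m : ℝ) - 1) := by
          rw [← rpow_one_add' hr.le (by linarith), ← rpow_natCast]; ring_nf
        have h7 : max R r ^ b = max R r ^ ((m : ℝ) - 1) * (max R r ^ α * max R r ^ α) := by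
          rw [← rpow_add hM, ← rpow_add hM, hb1]; ring_nf
        rw [h6, h7, mul_assoc]
        have h8 : r ^ ((m : ℝ) - 1) ≤ max R r ^ ((m : ℝ) - 1) :=
          rpow_le_rpow hr.le (le_max_right _ _) (by linarith)
        have h9 : R ^ α ≤ max R r ^ α := rpow_le_rpow hR0 (le_max_left _ _) hα
        have h10 : r ^ α ≤ max R r ^ α := rpow_le_rpow hr.le (le_max_right _ _) hα
        gcongr

theorem ofReal_gamma_mul_rpow_le_lintegral {s r : ℝ} (hs : 0 < s) (hr : 0 < r) :
    ENNReal.ofReal (Gamma s * r ^ (-s)) ≤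
      ∫⁻ l in Set.Ioi (0 : ℝ), ENNReal.ofReal (l ^ (s - 1) * exp (-(r * l))) := by
  have h := integral_rpow_mul_exp_neg_mul_Ioi hs hr
  have hint : IntegrableOn (fun t : ℝ => t ^ (s - 1) * exp (-(r * t))) (Set.Ioi 0) := by
    by_contra hc
    rw [integral_undef hc] at h
    have := Gamma_pos_of_pos hs
    have : 0 < (1 / r) ^ s * Gamma s := by positivity
    linarith
  rw [← ofReal_integral_eq_lintegral_ofReal hint, h, one_div, inv_rpow hr.le, rpow_neg hr.le,
    mul_comm]
  filter_upwards [ae_restrict_mem measurableSet_Ioi] with t ht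
  have : 0 < t := ht
  positivity

theorem exp_neg_le_rpow {a x : ℝ} (ha : 0 < a) (hx : 0 < x) : exp (-x) ≤ a ^ a * x ^ (-a) := by
  have h1 : x / a ≤ exp (x / a) := by linarith [add_one_le_exp (x / a)]
  have h2 : (x / a) ^ a ≤ exp x := by
    refine (rpow_le_rpow (by positivity) h1 ha.le).trans_eq ?_
    rw [← exp_mul, div_mul_cancel₀ _ ha.ne']
  rw [div_rpow hx.le ha.le, div_le_iff₀ (by positivity)] at h2
  rw [exp_neg, rpow_neg hx.le, ← div_eq_mul_inv, inv_le_comm₀ (exp_pos x) (by positivity), inv_div,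
    div_le_iff₀ (by positivity)]
  linarith

theorem lintegral_rpow_neg_mul_exp_neg_div_le {a D : ℝ} (ha : 1 < a) (hD : 0 < D) :
    ∫⁻ l in Set.Ioi (0 : ℝ), ENNReal.ofReal (l ^ (-a) * exp (-(D / l))) ≤
      ENNReal.ofReal ((a ^ a + 1 / (a - 1)) * D ^ (1 - a)) := by
  have ha0 : 0 < a := by linarith
  have ha1 : 0 < a - 1 := by linarith
  have hDa : D ^ (1 - a) = D ^ (-a) * D := by
    rw [← rpow_add_one hD.ne']; ring_nf
  rw [← Set.Ioc_union_Ioi_eq_Ioi hD.le, add_mul, ENNReal.ofReal_add (by positivity) (by positivity)]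
  refine (lintegral_union_le _ _ _).trans (add_le_add ?_ ?_)
  · calc _ ≤ ∫⁻ l in Set.Ioc 0 D, ENNReal.ofReal (a ^ a * D ^ (-a)) := by
          refine setLIntegral_mono' measurableSet_Ioc fun l hl => ENNReal.ofReal_le_ofReal ?_
          have hl0 : 0 < l := hl.1
          calc l ^ (-a) * exp (-(D / l)) ≤ l ^ (-a) * (a ^ a * (D / l) ^ (-a)) := by
                gcongr; exact exp_neg_le_rpow ha0 (by positivity)
            _ = a ^ a * D ^ (-a) := by
                rw [div_rpow hD.le hl0.le]
                have : l ^ (-a) ≠ 0 := (rpow_pos_of_pos hl0 _).ne'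
                field_simp
      _ = _ := by
          rw [setLIntegral_const, Real.volume_Ioc, ← ENNReal.ofReal_mul (by positivity), hDa]
          ring_nf
  · calc _ ≤ ∫⁻ l in Set.Ioi D, ENNReal.ofReal (l ^ (-a)) := by
          refine setLIntegral_mono' measurableSet_Ioi fun l hl => ENNReal.ofReal_le_ofReal ?_
          have hl0 : 0 < l := hD.trans hl
          refine mul_le_of_le_one_right (by positivity) (exp_le_one_iff.2 ?_)
          have : 0 < D / l := by positivity
          linarith
      _ = _ := by
          rw [← ofReal_integral_eq_lintegral_ofReal
            (integrableOn_Ioi_rpow_of_lt (by linarith) hD), integral_Ioi_rpow_of_lt (by linarith) hD]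
          · congr 1
            rw [show -a + 1 = -(a - 1) by ring, show 1 - a = -(a - 1) by ring]
            field_simp
          · filter_upwards [ae_restrict_mem measurableSet_Ioi] with l hl
            have : 0 < l := hD.trans hl
            positivity

theorem lintegral_sq_integral_le {X Y : Type*} [MeasurableSpace X] [MeasurableSpace Y]
    {μ : Measure X} {ν : Measure Y} [SFinite μ] [SFinite ν] {F : X → ℂ} (hF : Integrable F μ)
    {e : Y → X → ℂ} (he : Measurable (Function.uncurry e)) {g : Y → ℝ}
    (hg : Integrable (fun y => g y ^ 2) ν) (hge : ∀ y ξ, ‖e y ξ‖ ≤ g y) :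
    ∫⁻ y, ‖∫ ξ, F ξ * e y ξ ∂μ‖ₑ ^ 2 ∂ν ≤
      ∫⁻ p : X × X, ‖F p.1‖ₑ * ‖F p.2‖ₑ * ‖∫ y, e y p.1 * starRingEnd ℂ (e y p.2) ∂ν‖ₑ
        ∂μ.prod μ := by
  let A : Y → X × X → ℂ := fun y p =>
    (F p.1 * e y p.1) * starRingEnd ℂ (F p.2 * e y p.2)
  have hAmeas : AEStronglyMeasurable (Function.uncurry A) (ν.prod (μ.prod μ)) := by
    have e1 : Measurable fun q : Y × X × X => e q.1 q.2.1 :=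
      he.comp (measurable_fst.prodMk (measurable_fst.comp measurable_snd))
    have e2 : Measurable fun q : Y × X × X => e q.1 q.2.2 :=
      he.comp (measurable_fst.prodMk (measurable_snd.comp measurable_snd))
    have f1 : AEStronglyMeasurable (fun q : Y × X × X => F q.2.1) (ν.prod (μ.prod μ)) :=
      (hF.1.comp_fst (ν := μ)).comp_snd (μ := ν)
    have f2 : AEStronglyMeasurable (fun q : Y × X × X => F q.2.2) (ν.prod (μ.prod μ)) :=
      (hF.1.comp_snd (μ := μ)).comp_snd (μ := ν)
    exact (f1.mul e1.aestronglyMeasurable).mul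
      (Complex.continuous_conj.comp_aestronglyMeasurable (f2.mul e2.aestronglyMeasurable))
  have hA : Integrable (Function.uncurry A) (ν.prod (μ.prod μ)) := by
    refine (hg.mul_prod (hF.norm.mul_prod hF.norm)).mono' hAmeas (.of_forall fun ⟨y, p⟩ => ?_)
    have h0 : 0 ≤ g y := (norm_nonneg _).trans (hge y p.1)
    simp only [Function.uncurry, A, norm_mul, RCLike.norm_conj]
    calc _ = (‖e y p.1‖ * ‖e y p.2‖) * (‖F p.1‖ * ‖F p.2‖) := by ring
      _ ≤ (g y * g y) * (‖F p.1‖ * ‖F p.2‖) := by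
        gcongr
        exacts [hge y p.1, hge y p.2]
      _ = _ := by ring
  have hinner : ∀ y, ∫ p, A y p ∂μ.prod μ = ((‖∫ ξ, F ξ * e y ξ ∂μ‖ ^ 2 : ℝ) : ℂ) := fun y => by
    simp only [A]
    rw [integral_prod_mul (fun ξ => F ξ * e y ξ) (fun ξ => starRingEnd ℂ (F ξ * e y ξ)),
      integral_conj, Complex.mul_conj, Complex.normSq_eq_norm_sq]
  have hsq : Integrable (fun y => ‖∫ ξ, F ξ * e y ξ ∂μ‖ ^ 2) ν := by
    have := hA.integral_prod_left.norm
    refine this.congr (.of_forall fun y => ?_)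
    simp only [Function.uncurry]
    rw [hinner y, Complex.norm_real, Real.norm_of_nonneg (by positivity)]
  calc _ = ENNReal.ofReal (∫ y, ‖∫ ξ, F ξ * e y ξ ∂μ‖ ^ 2 ∂ν) := by
        rw [ofReal_integral_eq_lintegral_ofReal hsq (.of_forall fun y => by positivity)]
        refine lintegral_congr fun y => ?_
        rw [ENNReal.ofReal_pow (norm_nonneg _), ofReal_norm]
    _ = ‖∫ y, ∫ p, A y p ∂μ.prod μ ∂ν‖ₑ := by
        simp only [hinner]
        rw [integral_complex_ofReal, ← ofReal_norm, Complex.norm_real, Real.norm_of_nonneg]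
        exact integral_nonneg fun y => by positivity
    _ = ‖∫ p, ∫ y, A y p ∂ν ∂μ.prod μ‖ₑ := by rw [integral_integral_swap hA]
    _ ≤ _ := by
        refine (enorm_integral_le_lintegral_enorm _).trans_eq (lintegral_congr fun p => ?_)
        have : ∀ y, A y p = (F p.1 * starRingEnd ℂ (F p.2)) *
            (e y p.1 * starRingEnd ℂ (e y p.2)) := fun y => by
          simp only [A, map_mul]; ring
        simp only [this]
        rw [integral_const_mul, enorm_mul, enorm_mul, RCLike.enorm_conj]

theorem lintegral_gaussian_kernel {ε : ℝ} (hε : 0 < ε) :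
    ∫⁻ s : ℝ, ENNReal.ofReal ((π / ε) ^ (1 / 2 : ℝ) * exp (-(s ^ 2 / (4 * ε)))) =
      ENNReal.ofReal (2 * π) := by
  have h := integral_gaussian (1 / (4 * ε))
  have hi : Integrable fun s : ℝ => exp (-(1 / (4 * ε)) * s ^ 2) :=
    integrable_exp_neg_mul_sq (by positivity)
  have heq : ∀ s : ℝ, exp (-(s ^ 2 / (4 * ε))) = exp (-(1 / (4 * ε)) * s ^ 2) := fun s => by
    congr 1; ring
  simp only [heq]
  rw [← ofReal_integral_eq_lintegral_ofReal (hi.const_mul _) (.of_forall fun s => by positivity),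
    integral_const_mul, h, ← sqrt_eq_rpow, ← sqrt_mul (by positivity)]
  congr 1
  rw [show π / ε * (π / (1 / (4 * ε))) = (2 * π) ^ 2 by field_simp; ring]
  exact sqrt_sq (by positivity)

theorem integral_gaussian_mul_gaussian {n : ℕ} {l ε : ℝ} (hl : 0 < l) (hε : 0 < ε)
    (w : EuclideanSpace ℝ (Fin n)) (s : ℝ) :
    ‖∫ y : EuclideanSpace ℝ (Fin n) × ℝ,
        Complex.exp (-l * ‖y.1‖ ^ 2 + Complex.I * (inner ℝ w y.1 : ℝ)) *
          Complex.exp (-ε * ‖y.2‖ ^ 2 + -Complex.I * (inner ℝ s y.2 : ℝ))‖ₑ =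
      ENNReal.ofReal ((π / l) ^ (n / 2 : ℝ) * exp (-(‖w‖ ^ 2 / (4 * l)))) *
        ENNReal.ofReal ((π / ε) ^ (1 / 2 : ℝ) * exp (-(s ^ 2 / (4 * ε)))) := by
  rw [Measure.volume_eq_prod, integral_prod_mul
    (fun x : EuclideanSpace ℝ (Fin n) => Complex.exp (-l * ‖x‖ ^ 2 + Complex.I * (inner ℝ w x : ℝ)))
    (fun t : ℝ => Complex.exp (-ε * ‖t‖ ^ 2 + -Complex.I * (inner ℝ s t : ℝ))),
    GaussianFourier.integral_cexp_neg_mul_sq_norm_add (by simpa using hl),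
    GaussianFourier.integral_cexp_neg_mul_sq_norm_add (by simpa using hε), enorm_mul,
    ← ofReal_norm, ← ofReal_norm]
  congr 2
  · rw [norm_mul, Complex.norm_exp, show (π / l : ℂ) = ((π / l : ℝ) : ℂ) by push_cast; rfl,
      Complex.norm_cpow_eq_rpow_re_of_pos (by positivity)]
    congr 2
    · simp
    · rw [show Complex.I ^ 2 * (‖w‖ : ℂ) ^ 2 / (4 * l) = ((-(‖w‖ ^ 2 / (4 * l)) : ℝ) : ℂ) by
        rw [Complex.I_sq]; push_cast; ring]
      rw [Complex.ofReal_re]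
  · rw [norm_mul, Complex.norm_exp, show (π / ε : ℂ) = ((π / ε : ℝ) : ℂ) by push_cast; rfl,
      Complex.norm_cpow_eq_rpow_re_of_pos (by positivity)]
    congr 2
    · simp
    · rw [show (-Complex.I) ^ 2 * (‖s‖ : ℂ) ^ 2 / (4 * ε) = ((-(‖s‖ ^ 2 / (4 * ε)) : ℝ) : ℂ) by
        rw [neg_sq, Complex.I_sq]; push_cast; ring]
      rw [Complex.ofReal_re, Real.norm_eq_abs, sq_abs]

/-- The superposition of free Schrödinger waves with amplitude `F`. -/
noncomputable def schrodingerWave {n : ℕ} (F : EuclideanSpace ℝ (Fin n) → ℂ)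
    (y : EuclideanSpace ℝ (Fin n) × ℝ) : ℂ :=
  ∫ ξ : EuclideanSpace ℝ (Fin n), F ξ *
    (Complex.exp (Complex.I * ((inner ℝ y.1 ξ : ℝ) : ℂ)) *
      Complex.exp (-(Complex.I * (y.2 : ℂ) * ((‖ξ‖ ^ 2 : ℝ) : ℂ))))

theorem measurable_schrodingerWave {n : ℕ} {F : EuclideanSpace ℝ (Fin n) → ℂ}
    (hF : Measurable F) : Measurable (schrodingerWave F) := by
  have : StronglyMeasurable (Function.uncurry
      fun (y : EuclideanSpace ℝ (Fin n) × ℝ) (ξ : EuclideanSpace ℝ (Fin n)) => F ξ *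
    (Complex.exp (Complex.I * ((inner ℝ y.1 ξ : ℝ) : ℂ)) *
      Complex.exp (-(Complex.I * (y.2 : ℂ) * ((‖ξ‖ ^ 2 : ℝ) : ℂ))))) := by
    refine Measurable.stronglyMeasurable ((hF.comp measurable_snd).mul ?_)
    exact Continuous.measurable (by fun_prop)
  exact (this.integral_prod_right (ν := volume)).measurable

theorem lintegral_schrodingerWave_mul_gaussian_le {n : ℕ} {F : EuclideanSpace ℝ (Fin n) → ℂ}
    (hF : Integrable F) {l ε : ℝ} (hl : 0 < l) (hε : 0 < ε) :
    ∫⁻ y : EuclideanSpace ℝ (Fin n) × ℝ, ‖schrodingerWave F y‖ₑ ^ 2 *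
        ENNReal.ofReal (exp (-(ε * y.2 ^ 2))) * ENNReal.ofReal (exp (-(‖y.1‖ ^ 2 * l))) ≤
      ∫⁻ p : EuclideanSpace ℝ (Fin n) × EuclideanSpace ℝ (Fin n), ‖F p.1‖ₑ * ‖F p.2‖ₑ *
        (ENNReal.ofReal ((π / l) ^ (n / 2 : ℝ) * exp (-(‖p.1 - p.2‖ ^ 2 / (4 * l)))) *
          ENNReal.ofReal ((π / ε) ^ (1 / 2 : ℝ) *
            exp (-((‖p.1‖ ^ 2 - ‖p.2‖ ^ 2) ^ 2 / (4 * ε))))) := by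
  let g : EuclideanSpace ℝ (Fin n) × ℝ → ℝ := fun y =>
    exp (-(l / 2 * ‖y.1‖ ^ 2)) * exp (-(ε / 2 * y.2 ^ 2))
  let e : EuclideanSpace ℝ (Fin n) × ℝ → EuclideanSpace ℝ (Fin n) → ℂ := fun y ξ =>
    (g y : ℂ) * (Complex.exp (Complex.I * ((inner ℝ y.1 ξ : ℝ) : ℂ)) *
      Complex.exp (-(Complex.I * (y.2 : ℂ) * ((‖ξ‖ ^ 2 : ℝ) : ℂ))))
  have hgsq : ∀ y, g y ^ 2 = exp (-l * ‖y.1‖ ^ 2) * exp (-ε * y.2 ^ 2) := fun y => by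
    simp only [g]
    rw [mul_pow, ← exp_nat_mul, ← exp_nat_mul]
    congr 2 <;> (push_cast; ring)
  have hg0 : ∀ y, 0 ≤ g y := fun y => by positivity
  have hg : Integrable (fun y => g y ^ 2) := by
    simp only [hgsq]
    refine Integrable.mul_prod (f := fun x : EuclideanSpace ℝ (Fin n) => exp (-l * ‖x‖ ^ 2))
      ?_ (integrable_exp_neg_mul_sq hε)
    have := (GaussianFourier.integrable_cexp_neg_mul_sq_norm_add
      (V := EuclideanSpace ℝ (Fin n)) (b := l) (by simpa using hl) 0 0).norm
    refine this.congr (.of_forall fun x => ?_)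
    simp only [Complex.norm_exp]
    congr 1
    rw [show (-(l : ℂ) * (‖x‖ : ℂ) ^ 2 + 0 * ((inner ℝ 0 x : ℝ) : ℂ)) =
      ((-l * ‖x‖ ^ 2 : ℝ) : ℂ) by push_cast; ring, Complex.ofReal_re]
  have hphase : ∀ (y : EuclideanSpace ℝ (Fin n) × ℝ) (ξ : EuclideanSpace ℝ (Fin n)),
      ‖Complex.exp (Complex.I * ((inner ℝ y.1 ξ : ℝ) : ℂ)) *
      Complex.exp (-(Complex.I * (y.2 : ℂ) * ((‖ξ‖ ^ 2 : ℝ) : ℂ)))‖ = 1 := by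
    intro y ξ
    rw [← Complex.exp_add, Complex.norm_exp]
    simp [-Complex.ofReal_pow]
  have hem : Measurable (Function.uncurry e) := Continuous.measurable (by
    simp only [e, g, Function.uncurry_def]; fun_prop)
  have key := lintegral_sq_integral_le hF hem hg (fun y ξ => by
    simp only [e]
    rw [norm_mul, hphase, mul_one, Complex.norm_real, Real.norm_of_nonneg (hg0 y)])
  refine le_trans (le_of_eq ?_) (key.trans (le_of_eq ?_))
  · refine lintegral_congr fun y => ?_
    have h1 : ∫ ξ, F ξ * e y ξ = (g y : ℂ) * schrodingerWave F y := by
      rw [schrodingerWave, ← integral_const_mul]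
      refine integral_congr_ae (.of_forall fun ξ => ?_)
      simp only [e]; ring
    rw [h1, enorm_mul, mul_pow, ← ofReal_norm ((g y : ℂ)), Complex.norm_real,
      Real.norm_of_nonneg (hg0 y), ← ENNReal.ofReal_pow (hg0 y), hgsq,
      ENNReal.ofReal_mul (exp_nonneg _)]
    rw [mul_comm (‖y.1‖ ^ 2) l, neg_mul, neg_mul]
    ring
  · rw [Measure.volume_eq_prod]
    refine lintegral_congr fun p => ?_
    rw [← integral_gaussian_mul_gaussian hl hε]
    congr 2
    refine integral_congr_ae (.of_forall fun y => ?_)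
    simp only [e, map_mul, ← Complex.exp_conj, map_neg, Complex.conj_I, Complex.conj_ofReal]
    have : ∀ a b c d f h : ℂ, a * (b * c) * (d * (f * h)) = (a * d) * ((b * f) * (c * h)) := by
      intros; ring
    rw [this, ← Complex.ofReal_mul, ← sq, hgsq]
    push_cast
    simp only [← Complex.exp_add]
    congr 1
    rw [inner_sub_left, real_inner_comm y.1 p.1, real_inner_comm y.1 p.2]
    simp only [Real.norm_eq_abs, RCLike.inner_apply, conj_trivial]
    rw [← Complex.ofReal_pow |y.2|, sq_abs]
    push_cast
    ring

/-- The kernel arising from integrating a wave against the time cutoff `exp (-ε t²)`. -/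
noncomputable def timeKernel (ε s : ℝ) : ℝ≥0∞ :=
  ENNReal.ofReal ((π / ε) ^ (1 / 2 : ℝ) * exp (-(s ^ 2 / (4 * ε))))

theorem measurable_timeKernel (ε : ℝ) : Measurable (timeKernel ε) := by
  unfold timeKernel
  fun_prop

theorem exists_lintegral_gaussian_superposition_le (n : ℕ) (hn : 3 ≤ n) {α : ℝ} (hα : 0 ≤ α) :
    ∃ C : ℝ≥0∞, C < ∞ ∧ ∀ d : EuclideanSpace ℝ (Fin n),
      ∫⁻ l in Set.Ioi (0 : ℝ), ENNReal.ofReal (l ^ (-α)) *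
          ENNReal.ofReal ((π / l) ^ (n / 2 : ℝ) * exp (-(‖d‖ ^ 2 / (4 * l)))) ≤
        C * ‖d‖ₑ ^ (-((n : ℝ) - 2 + 2 * α)) := by
  have hn' : (3 : ℝ) ≤ n := by exact_mod_cast hn
  set a : ℝ := α + n / 2 with ha
  have ha1 : 1 < a := by rw [ha]; linarith
  have ha2 : 0 < a - 1 := by linarith
  set c : ℝ := π ^ (n / 2 : ℝ) * ((a ^ a + 1 / (a - 1)) * (1 / 4) ^ (1 - a)) with hc
  have hc0 : 0 < c := by
    have : 0 < a := by linarith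
    positivity
  refine ⟨ENNReal.ofReal c, ENNReal.ofReal_lt_top, fun d => ?_⟩
  rcases eq_or_ne d 0 with rfl | hd
  · rw [enorm_zero, ENNReal.zero_rpow_of_neg (by linarith),
      ENNReal.mul_top (by simpa using hc0)]
    exact le_top
  have hd0 : 0 < ‖d‖ := norm_pos_iff.2 hd
  have hD : 0 < ‖d‖ ^ 2 / 4 := by positivity
  calc _ = ∫⁻ l in Set.Ioi (0 : ℝ), ENNReal.ofReal (π ^ (n / 2 : ℝ)) *
        ENNReal.ofReal (l ^ (-a) * exp (-((‖d‖ ^ 2 / 4) / l))) := by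
        refine setLIntegral_congr_fun measurableSet_Ioi fun l hl => ?_
        have hl : 0 < l := hl
        rw [← ENNReal.ofReal_mul (by positivity), ← ENNReal.ofReal_mul (by positivity),
          div_rpow pi_pos.le hl.le, ha, neg_add, rpow_add hl, rpow_neg hl.le (n / 2 : ℝ), div_div]
        congr 1
        ring
    _ ≤ ENNReal.ofReal (π ^ (n / 2 : ℝ)) *
        ENNReal.ofReal ((a ^ a + 1 / (a - 1)) * (‖d‖ ^ 2 / 4) ^ (1 - a)) := by
        rw [lintegral_const_mul _ (by fun_prop)]
        gcongr
        exact lintegral_rpow_neg_mul_exp_neg_div_le ha1 hD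
    _ = _ := by
        rw [← ofReal_norm, ENNReal.ofReal_rpow_of_pos hd0, ← ENNReal.ofReal_mul (by positivity),
          ← ENNReal.ofReal_mul hc0.le, hc, div_eq_mul_one_div (‖d‖ ^ 2) 4,
          mul_rpow (by positivity) (by positivity), ← rpow_natCast, ← rpow_mul hd0.le,
          show ((2 : ℕ) : ℝ) * (1 - a) = -((n : ℝ) - 2 + 2 * α) by rw [ha]; push_cast; ring]
        congr 1
        ring

theorem exists_lintegral_weighted_wave_le (n : ℕ) (hn : 3 ≤ n) {α : ℝ} (hα : 0 ≤ α)
    (hα' : α < 1 / 2) :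
    ∃ C : ℝ≥0∞, C < ∞ ∧ ∀ F : EuclideanSpace ℝ (Fin n) → ℂ, Measurable F → Integrable F →
      ∀ ε : ℝ, 0 < ε →
      ∫⁻ y : EuclideanSpace ℝ (Fin n) × ℝ, ‖schrodingerWave F y‖ₑ ^ 2 *
        ENNReal.ofReal (exp (-(ε * y.2 ^ 2))) * ENNReal.ofReal ((‖y.1‖ ^ 2) ^ (-(1 - α))) ≤
      C * ∫⁻ p : EuclideanSpace ℝ (Fin n) × EuclideanSpace ℝ (Fin n), ‖F p.1‖ₑ * ‖F p.2‖ₑ *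
        (‖p.1 - p.2‖ₑ ^ (-((n : ℝ) - 2 + 2 * α)) * timeKernel ε (‖p.1‖ ^ 2 - ‖p.2‖ ^ 2)) := by
  obtain ⟨C, hC, hCle⟩ := exists_lintegral_gaussian_superposition_le n hn hα
  have hΓ : 0 < Gamma (1 - α) := Gamma_pos_of_pos (by linarith)
  have hΓ0 : ENNReal.ofReal (Gamma (1 - α)) ≠ 0 := by simpa using hΓ
  refine ⟨(ENNReal.ofReal (Gamma (1 - α)))⁻¹ * C,
    ENNReal.mul_lt_top (ENNReal.inv_lt_top.2 (by simpa using hΓ)) hC, fun F hFm hF ε hε => ?_⟩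
  have hk := measurable_timeKernel ε
  have hU := measurable_schrodingerWave hFm
  rw [mul_assoc, mul_comm, ← div_eq_mul_inv,
    ENNReal.le_div_iff_mul_le (Or.inl hΓ0) (Or.inl ENNReal.ofReal_ne_top), mul_comm]
  calc _ = ∫⁻ y : EuclideanSpace ℝ (Fin n) × ℝ, ‖schrodingerWave F y‖ₑ ^ 2 *
        ENNReal.ofReal (exp (-(ε * y.2 ^ 2))) *
          ENNReal.ofReal (Gamma (1 - α) * (‖y.1‖ ^ 2) ^ (-(1 - α))) := by
        rw [← lintegral_const_mul' _ _ ENNReal.ofReal_ne_top]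
        refine lintegral_congr fun y => ?_
        rw [ENNReal.ofReal_mul hΓ.le]
        ring
    _ ≤ ∫⁻ y : EuclideanSpace ℝ (Fin n) × ℝ, ∫⁻ l in Set.Ioi (0 : ℝ),
          ENNReal.ofReal (l ^ (-α)) * (‖schrodingerWave F y‖ₑ ^ 2 *
            ENNReal.ofReal (exp (-(ε * y.2 ^ 2))) * ENNReal.ofReal (exp (-(‖y.1‖ ^ 2 * l)))) := by
        refine lintegral_mono fun y => ?_
        calc _ ≤ ‖schrodingerWave F y‖ₑ ^ 2 * ENNReal.ofReal (exp (-(ε * y.2 ^ 2))) *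
              ∫⁻ l in Set.Ioi (0 : ℝ),
                ENNReal.ofReal (l ^ ((1 - α) - 1) * exp (-(‖y.1‖ ^ 2 * l))) := by
              gcongr
              rcases eq_or_ne y.1 0 with h0 | h0
              · rw [h0, norm_zero, zero_pow two_ne_zero, zero_rpow (by linarith), mul_zero,
                  ENNReal.ofReal_zero]
                exact zero_le
              · have := norm_pos_iff.2 h0
                exact ofReal_gamma_mul_rpow_le_lintegral (by linarith) (by positivity)
          _ = _ := by
              rw [← lintegral_const_mul _ (by fun_prop)]
              refine setLIntegral_congr_fun measurableSet_Ioi fun l hl => ?_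
              have hl : 0 < l := hl
              rw [show 1 - α - 1 = -α by ring, ENNReal.ofReal_mul (by positivity)]
              ring
    _ = ∫⁻ l in Set.Ioi (0 : ℝ), ENNReal.ofReal (l ^ (-α)) *
          ∫⁻ y : EuclideanSpace ℝ (Fin n) × ℝ, ‖schrodingerWave F y‖ₑ ^ 2 *
            ENNReal.ofReal (exp (-(ε * y.2 ^ 2))) * ENNReal.ofReal (exp (-(‖y.1‖ ^ 2 * l))) := by
        rw [lintegral_lintegral_swap]
        · refine lintegral_congr fun l => ?_
          rw [lintegral_const_mul' _ _ ENNReal.ofReal_ne_top]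
        · refine Measurable.aemeasurable ?_
          simp only [Function.uncurry_def]
          fun_prop
    _ ≤ ∫⁻ l in Set.Ioi (0 : ℝ), ENNReal.ofReal (l ^ (-α)) *
          ∫⁻ p : EuclideanSpace ℝ (Fin n) × EuclideanSpace ℝ (Fin n), ‖F p.1‖ₑ * ‖F p.2‖ₑ *
            (ENNReal.ofReal ((π / l) ^ (n / 2 : ℝ) * exp (-(‖p.1 - p.2‖ ^ 2 / (4 * l)))) *
              timeKernel ε (‖p.1‖ ^ 2 - ‖p.2‖ ^ 2)) := by
        refine setLIntegral_mono' measurableSet_Ioi fun l hl => ?_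
        gcongr
        exact lintegral_schrodingerWave_mul_gaussian_le hF hl hε
    _ = ∫⁻ p : EuclideanSpace ℝ (Fin n) × EuclideanSpace ℝ (Fin n), ‖F p.1‖ₑ * ‖F p.2‖ₑ *
          timeKernel ε (‖p.1‖ ^ 2 - ‖p.2‖ ^ 2) * ∫⁻ l in Set.Ioi (0 : ℝ),
            ENNReal.ofReal (l ^ (-α)) *
              ENNReal.ofReal ((π / l) ^ (n / 2 : ℝ) * exp (-(‖p.1 - p.2‖ ^ 2 / (4 * l)))) := by
        have h1 : ∀ l : ℝ, ENNReal.ofReal (l ^ (-α)) *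
            ∫⁻ p : EuclideanSpace ℝ (Fin n) × EuclideanSpace ℝ (Fin n), ‖F p.1‖ₑ * ‖F p.2‖ₑ *
            (ENNReal.ofReal ((π / l) ^ (n / 2 : ℝ) * exp (-(‖p.1 - p.2‖ ^ 2 / (4 * l)))) *
              timeKernel ε (‖p.1‖ ^ 2 - ‖p.2‖ ^ 2)) =
            ∫⁻ p : EuclideanSpace ℝ (Fin n) × EuclideanSpace ℝ (Fin n), ‖F p.1‖ₑ * ‖F p.2‖ₑ *
              timeKernel ε (‖p.1‖ ^ 2 - ‖p.2‖ ^ 2) * (ENNReal.ofReal (l ^ (-α)) *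
              ENNReal.ofReal ((π / l) ^ (n / 2 : ℝ) * exp (-(‖p.1 - p.2‖ ^ 2 / (4 * l))))) := by
          intro l
          rw [← lintegral_const_mul' _ _ ENNReal.ofReal_ne_top]
          exact lintegral_congr fun p => by ring
        simp only [h1]
        rw [lintegral_lintegral_swap]
        · refine lintegral_congr fun p => ?_
          rw [lintegral_const_mul _ (by fun_prop)]
        · refine Measurable.aemeasurable ?_
          simp only [Function.uncurry_def]
          fun_prop
    _ ≤ _ := by
        rw [← lintegral_const_mul' _ _ hC.ne]
        refine lintegral_mono fun p => ?_
        calc _ ≤ ‖F p.1‖ₑ * ‖F p.2‖ₑ * timeKernel ε (‖p.1‖ ^ 2 - ‖p.2‖ ^ 2) *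
              (C * ‖p.1 - p.2‖ₑ ^ (-((n : ℝ) - 2 + 2 * α))) := by
              gcongr
              exact hCle _
          _ = _ := by ring

theorem lintegral_prod_mul_kernel_le {X : Type*} [MeasurableSpace X] {μ : Measure X} [SFinite μ]
    {f : X → ℝ≥0∞} (hf : Measurable f) {K : X × X → ℝ≥0∞} (hK : Measurable K)
    (hsymm : ∀ x y, K (x, y) = K (y, x)) {A : ℝ≥0∞} (hA : ∀ x, ∫⁻ y, K (x, y) ∂μ ≤ A) :
    ∫⁻ p, f p.1 * f p.2 * K p ∂μ.prod μ ≤ 2 * A * ∫⁻ x, f x ^ 2 ∂μ := by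
  have hsq : ∀ a b : ℝ≥0∞, a * b ≤ a ^ 2 + b ^ 2 := fun a b => by
    rcases le_total a b with h | h
    · exact (mul_le_mul' h le_rfl).trans (by rw [← sq]; exact le_add_self)
    · exact (mul_le_mul' le_rfl h).trans (by rw [← sq]; exact le_self_add)
  have h1 : ∫⁻ p, f p.1 ^ 2 * K p ∂μ.prod μ ≤ A * ∫⁻ x, f x ^ 2 ∂μ := by
    rw [lintegral_prod _ (by fun_prop), ← lintegral_const_mul _ (by fun_prop)]
    refine lintegral_mono fun x => ?_
    simp only
    rw [lintegral_const_mul _ (by fun_prop), mul_comm A]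
    gcongr
    exact hA x
  have h2 : ∫⁻ p, f p.2 ^ 2 * K p ∂μ.prod μ = ∫⁻ p, f p.1 ^ 2 * K p ∂μ.prod μ := by
    rw [← lintegral_prod_swap]
    exact lintegral_congr fun p => by rw [Prod.swap, hsymm]
  calc _ ≤ ∫⁻ p, (f p.1 ^ 2 * K p + f p.2 ^ 2 * K p) ∂μ.prod μ := by
        refine lintegral_mono fun p => ?_
        rw [← add_mul]
        gcongr
        exact hsq _ _
    _ = ∫⁻ p, f p.1 ^ 2 * K p ∂μ.prod μ + ∫⁻ p, f p.2 ^ 2 * K p ∂μ.prod μ :=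
        lintegral_add_left (by fun_prop) _
    _ ≤ _ := by
        rw [h2, ← two_mul, mul_assoc]
        gcongr

theorem exists_lintegral_wave_le (n : ℕ) (hn : 3 ≤ n) {α : ℝ} (hα : 0 ≤ α) (hα' : α < 1 / 2) :
    ∃ C : ℝ≥0∞, C < ∞ ∧ ∀ f : EuclideanSpace ℝ (Fin n) → ℂ, Measurable f →
      Integrable (fun ξ => ((‖ξ‖ ^ α : ℝ) : ℂ) * f ξ) →
      ∫⁻ y : EuclideanSpace ℝ (Fin n) × ℝ,
        ‖schrodingerWave (fun ξ => ((‖ξ‖ ^ α : ℝ) : ℂ) * f ξ) y‖ₑ ^ 2 *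
          ENNReal.ofReal ((‖y.1‖ ^ 2) ^ (-(1 - α))) ≤ C * ∫⁻ ξ, ‖f ξ‖ₑ ^ 2 := by
  obtain ⟨C, hC, hCle⟩ := exists_lintegral_weighted_wave_le n hn hα hα'
  obtain ⟨Q, hQ, hQle⟩ := exists_lintegral_kernel_le n hn hα hα'
  refine ⟨C * (2 * (Q * ENNReal.ofReal (2 * π))),
    ENNReal.mul_lt_top hC (ENNReal.mul_lt_top (by simp)
      (ENNReal.mul_lt_top hQ ENNReal.ofReal_lt_top)), fun f hfm hf => ?_⟩
  have hFm : Measurable fun ξ : EuclideanSpace ℝ (Fin n) => ((‖ξ‖ ^ α : ℝ) : ℂ) * f ξ := by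
    fun_prop
  have hU := measurable_schrodingerWave hFm
  set U := schrodingerWave (fun ξ : EuclideanSpace ℝ (Fin n) => ((‖ξ‖ ^ α : ℝ) : ℂ) * f ξ) with hUdef
  have hbound : ∀ ε : ℝ, 0 < ε → ∫⁻ y, ‖U y‖ₑ ^ 2 *
      ENNReal.ofReal (exp (-(ε * y.2 ^ 2))) * ENNReal.ofReal ((‖y.1‖ ^ 2) ^ (-(1 - α))) ≤
      C * (2 * (Q * ENNReal.ofReal (2 * π))) * ∫⁻ ξ, ‖f ξ‖ₑ ^ 2 := by
    intro ε hε
    have hk := measurable_timeKernel ε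
    refine (hCle _ hFm hf ε hε).trans ?_
    rw [mul_assoc C]
    gcongr
    have hker := lintegral_prod_mul_kernel_le (μ := volume) (f := fun ξ => ‖f ξ‖ₑ)
      (K := fun p : EuclideanSpace ℝ (Fin n) × EuclideanSpace ℝ (Fin n) =>
        ENNReal.ofReal (‖p.1‖ ^ α * ‖p.2‖ ^ α) *
        (‖p.1 - p.2‖ₑ ^ (-((n : ℝ) - 2 + 2 * α)) * timeKernel ε (‖p.1‖ ^ 2 - ‖p.2‖ ^ 2)))
      (by fun_prop) (by fun_prop)
      (fun x y => by
        simp only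
        rw [mul_comm (‖x‖ ^ α), enorm_sub_rev x y, timeKernel, timeKernel,
          ← neg_sub (‖y‖ ^ 2), neg_sq])
      (A := Q * ENNReal.ofReal (2 * π))
      (fun x => by
        rw [← lintegral_gaussian_kernel hε]
        exact hQle (timeKernel ε) hk x)
    refine le_trans (le_of_eq ?_) hker
    rw [← Measure.volume_eq_prod]
    refine lintegral_congr fun p => ?_
    simp only [enorm_mul]
    rw [ENNReal.ofReal_mul (by positivity), ← ofReal_norm ((‖p.1‖ ^ α : ℝ) : ℂ),
      ← ofReal_norm ((‖p.2‖ ^ α : ℝ) : ℂ), Complex.norm_real, Complex.norm_real,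
      Real.norm_of_nonneg (by positivity), Real.norm_of_nonneg (by positivity)]
    ring
  let ε : ℕ → ℝ := fun k => 1 / ((k : ℝ) + 1)
  have hlim : ∀ y : EuclideanSpace ℝ (Fin n) × ℝ, Filter.Tendsto (fun k : ℕ => ‖U y‖ₑ ^ 2 *
      ENNReal.ofReal (exp (-(ε k * y.2 ^ 2))) * ENNReal.ofReal ((‖y.1‖ ^ 2) ^ (-(1 - α))))
      Filter.atTop (nhds (‖U y‖ₑ ^ 2 * ENNReal.ofReal ((‖y.1‖ ^ 2) ^ (-(1 - α))))) := by
    intro y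
    have h1 : Filter.Tendsto (fun k => ENNReal.ofReal (exp (-(ε k * y.2 ^ 2)))) Filter.atTop
        (nhds 1) := by
      have h2 : Filter.Tendsto (fun k => exp (-(ε k * y.2 ^ 2))) Filter.atTop
          (nhds (exp (-(0 * y.2 ^ 2)))) :=
        (continuous_exp.tendsto _).comp
          ((tendsto_one_div_add_atTop_nhds_zero_nat.mul_const _).neg)
      simpa using ENNReal.tendsto_ofReal h2
    have h3 := ENNReal.Tendsto.mul_const (b := ENNReal.ofReal ((‖y.1‖ ^ 2) ^ (-(1 - α))))
      (ENNReal.Tendsto.const_mul (a := ‖U y‖ₑ ^ 2) h1 (Or.inr (by simp))) (Or.inr (by simp))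
    simpa using h3
  calc _ = ∫⁻ y, Filter.liminf (fun k : ℕ => ‖U y‖ₑ ^ 2 *
        ENNReal.ofReal (exp (-(ε k * y.2 ^ 2))) *
          ENNReal.ofReal ((‖y.1‖ ^ 2) ^ (-(1 - α)))) Filter.atTop :=
        lintegral_congr fun y => (hlim y).liminf_eq.symm
    _ ≤ Filter.liminf (fun k : ℕ => ∫⁻ y, ‖U y‖ₑ ^ 2 *
        ENNReal.ofReal (exp (-(ε k * y.2 ^ 2))) *
          ENNReal.ofReal ((‖y.1‖ ^ 2) ^ (-(1 - α)))) Filter.atTop :=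
        lintegral_liminf_le fun k => by fun_prop
    _ ≤ _ := Filter.liminf_le_of_le (by isBoundedDefault) fun b hb => by
        obtain ⟨k, hk⟩ := hb.exists
        exact hk.trans (hbound (ε k) (by positivity))

theorem fourierInt_eq_fourier {n : ℕ} (φ : 𝓢(EuclideanSpace ℝ (Fin n), ℂ))
    (ξ : EuclideanSpace ℝ (Fin n)) :
    fourierInt (fun y => φ y) ξ = FourierTransform.fourier φ ((2 * π)⁻¹ • ξ) := by
  rw [SchwartzMap.fourier_coe, Real.fourier_eq', fourierInt]
  refine integral_congr_ae (.of_forall fun x => ?_)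
  simp only [smul_eq_mul, inner_smul_right]
  congr 2
  rw [show -2 * π * ((2 * π)⁻¹ * inner ℝ x ξ) = -inner ℝ x ξ by field_simp]
  push_cast
  ring

theorem lintegral_fourierInt_sq {n : ℕ} (φ : 𝓢(EuclideanSpace ℝ (Fin n), ℂ)) :
    ∫⁻ ξ, ‖fourierInt (fun y => φ y) ξ‖ₑ ^ 2 =
      ENNReal.ofReal ((2 * π) ^ n * ∫ x, ‖φ x‖ ^ 2) := by
  have hint : Integrable fun ξ => ‖FourierTransform.fourier φ ξ‖ ^ 2 :=
    ((FourierTransform.fourier φ).memLp 2 volume).integrable_norm_pow two_ne_zero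
  have hint' := hint.comp_smul (R := (2 * π)⁻¹) (by positivity)
  have hval := Measure.integral_comp_smul (volume : Measure (EuclideanSpace ℝ (Fin n)))
    (fun ξ => ‖FourierTransform.fourier φ ξ‖ ^ 2) (2 * π)⁻¹
  rw [SchwartzMap.integral_norm_sq_fourier, finrank_euclideanSpace_fin, inv_pow, inv_inv,
    abs_of_pos (by positivity), smul_eq_mul] at hval
  rw [← hval, ofReal_integral_eq_lintegral_ofReal hint' (.of_forall fun ξ => by positivity)]
  refine lintegral_congr fun ξ => ?_
  rw [fourierInt_eq_fourier, ENNReal.ofReal_pow (norm_nonneg _), ofReal_norm]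

theorem continuous_fourierInt {n : ℕ} (φ : 𝓢(EuclideanSpace ℝ (Fin n), ℂ)) :
    Continuous (fourierInt fun y => φ y) := by
  rw [show (fourierInt fun y => φ y) = fun ξ => FourierTransform.fourier φ ((2 * π)⁻¹ • ξ) from
    funext fun ξ => fourierInt_eq_fourier φ ξ]
  exact (FourierTransform.fourier φ).continuous.comp (continuous_const_smul _)

theorem integrable_rpow_mul_fourierInt {n : ℕ} {α : ℝ} (hα : 0 ≤ α) (hα' : α ≤ 1)
    (φ : 𝓢(EuclideanSpace ℝ (Fin n), ℂ)) :
    Integrable fun ξ => ((‖ξ‖ ^ α : ℝ) : ℂ) * fourierInt (fun y => φ y) ξ := by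
  have h0 := ((FourierTransform.fourier φ).integrable_pow_mul volume 0).comp_smul
    (R := (2 * π)⁻¹) (by positivity)
  have h1 := ((FourierTransform.fourier φ).integrable_pow_mul volume 1).comp_smul
    (R := (2 * π)⁻¹) (by positivity)
  refine (h0.add (h1.const_mul (2 * π))).mono' ?_ (.of_forall fun ξ => ?_)
  · have := (continuous_fourierInt φ).measurable
    exact Measurable.aestronglyMeasurable (by fun_prop)
  · rw [norm_mul, Complex.norm_real, Real.norm_of_nonneg (by positivity), fourierInt_eq_fourier]
    simp only [Pi.add_apply, pow_zero, one_mul, pow_one, norm_smul, norm_inv]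
    rw [Real.norm_of_nonneg (by positivity : (0 : ℝ) ≤ 2 * π),
      show 2 * π * ((2 * π)⁻¹ * ‖ξ‖ * ‖FourierTransform.fourier φ ((2 * π)⁻¹ • ξ)‖) =
        ‖ξ‖ * ‖FourierTransform.fourier φ ((2 * π)⁻¹ • ξ)‖ by field_simp, ← one_add_mul]
    gcongr
    rcases le_total ‖ξ‖ 1 with h | h
    · linarith [rpow_le_one (norm_nonneg ξ) h hα, norm_nonneg ξ]
    · have := rpow_le_rpow_of_exponent_le h hα'
      rw [rpow_one] at this
      linarith

theorem gradProp_two_eq {n : ℕ} (α : ℝ) (φ : 𝓢(EuclideanSpace ℝ (Fin n), ℂ))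
    (x : EuclideanSpace ℝ (Fin n)) (t : ℝ) :
    gradProp α 2 φ x t = ((2 * π) ^ n : ℝ)⁻¹ *
      schrodingerWave (fun ξ => ((‖ξ‖ ^ α : ℝ) : ℂ) * fourierInt (fun y => φ y) ξ) (x, t) := by
  rw [gradProp, schrodingerWave]
  congr 1
  refine integral_congr_ae (.of_forall fun ξ => ?_)
  simp only [rpow_two]
  ring

theorem enorm_integral_integral_le {X Y : Type*} [MeasurableSpace X] [MeasurableSpace Y]
    (μ : Measure X) (ν : Measure Y) (f : X → Y → ℝ) :
    ‖∫ x, ∫ y, f x y ∂ν ∂μ‖ₑ ≤ ∫⁻ x, ∫⁻ y, ‖f x y‖ₑ ∂ν ∂μ :=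
  (enorm_integral_le_lintegral_enorm _).trans
    (lintegral_mono fun _ => enorm_integral_le_lintegral_enorm _)

/-- Classical Kato smoothing estimate for the free Schrödinger equation (`β = 2`),
`n ≥ 3`, `0 ≤ α < 1/2`. -/
theorem kato_smoothing_free_schrodinger (n : ℕ) (hn : 3 ≤ n) (α : ℝ) (hα : 0 ≤ α)
    (hα' : α < 1 / 2) :
    ∃ C : ℝ, ∀ φ₀ : SchwartzMap (EuclideanSpace ℝ (Fin n)) ℂ,
      (∫ t : ℝ, ∫ x : EuclideanSpace ℝ (Fin n),
          ‖gradProp α 2 φ₀ x t‖ ^ 2 / ‖x‖ ^ (2 - 2 * α)) ≤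
        C * ∫ x : EuclideanSpace ℝ (Fin n), ‖φ₀ x‖ ^ 2 := by
  obtain ⟨C, hC, hCle⟩ := exists_lintegral_wave_le n hn hα hα'
  set c : ℝ := ((2 * π) ^ n : ℝ)⁻¹ with hc
  have hc0 : 0 ≤ c := by positivity
  refine ⟨c ^ 2 * (C.toReal * (2 * π) ^ n), fun φ₀ => ?_⟩
  have hfm := (continuous_fourierInt φ₀).measurable
  have hle := hCle _ hfm (integrable_rpow_mul_fourierInt hα (by linarith) φ₀)
  have hU := measurable_schrodingerWave (F := fun ξ : EuclideanSpace ℝ (Fin n) =>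
    ((‖ξ‖ ^ α : ℝ) : ℂ) * fourierInt (fun y => φ₀ y) ξ) (by fun_prop)
  set U := schrodingerWave (fun ξ : EuclideanSpace ℝ (Fin n) =>
    ((‖ξ‖ ^ α : ℝ) : ℂ) * fourierInt (fun y => φ₀ y) ξ) with hUdef
  rw [lintegral_fourierInt_sq] at hle
  have hJ : 0 ≤ ∫ x, ‖φ₀ x‖ ^ 2 := integral_nonneg fun x => by positivity
  have hpt : ∀ t x, ‖‖gradProp α 2 φ₀ x t‖ ^ 2 / ‖x‖ ^ (2 - 2 * α)‖ₑ =
      ENNReal.ofReal (c ^ 2) *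
        (‖U (x, t)‖ₑ ^ 2 * ENNReal.ofReal ((‖x‖ ^ 2) ^ (-(1 - α)))) := fun t x => by
    rw [gradProp_two_eq, ← hUdef, ← ofReal_norm, Real.norm_of_nonneg (by positivity), norm_mul,
      Complex.norm_real, ← hc, Real.norm_of_nonneg hc0, mul_pow,
      ← ofReal_norm (U (x, t)), ← ENNReal.ofReal_pow (norm_nonneg _),
      ← ENNReal.ofReal_mul (by positivity), ← ENNReal.ofReal_mul (by positivity),
      ← rpow_natCast ‖x‖ 2, ← rpow_mul (norm_nonneg x),
      show ((2 : ℕ) : ℝ) * -(1 - α) = -(2 - 2 * α) by push_cast; ring, rpow_neg (norm_nonneg x),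
      div_eq_mul_inv, mul_assoc]
  refine (le_norm_self _).trans ((ENNReal.ofReal_le_ofReal_iff (by positivity)).1 ?_)
  rw [ofReal_norm]
  refine (enorm_integral_integral_le _ _ _).trans ?_
  simp only [hpt]
  simp_rw [lintegral_const_mul' _ _ ENNReal.ofReal_ne_top]
  rw [← lintegral_prod_symm (fun y : EuclideanSpace ℝ (Fin n) × ℝ =>
    ‖U y‖ₑ ^ 2 * ENNReal.ofReal ((‖y.1‖ ^ 2) ^ (-(1 - α)))) (by fun_prop),
    ← Measure.volume_eq_prod, mul_assoc, ENNReal.ofReal_mul (by positivity), mul_assoc,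
    ENNReal.ofReal_mul ENNReal.toReal_nonneg, ENNReal.ofReal_toReal hC.ne]
  gcongr
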